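/- Let A ⊆ ℕ^ℕ be an analytic set. Then either A contains all branches of some Laver tree (there is a Laver tree T with [T] ⊆ A), or A belongs to the Laver ideal. -/

import Mathlib

open Set Filter

/-- The restriction of `x : ℕ → ℕ` to `{0,…,n-1}`, as a finite sequence. -/
def seg (x : ℕ → ℕ) (n : ℕ) : List ℕ := List.ofFn fun i : Fin n => x i

/-- `s` is the stem of the tree `T`: it belongs to `T`, is comparable with every
element of `T`, and every node of `T` extending it splits infinitely. -/
def IsStemOf (T : Set (List ℕ)) (s : List ℕ) : Prop :=
  s ∈ T ∧ (∀ t ∈ T, t <+: s ∨ s <+: t) ∧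
    ∀ t ∈ T, s <+: t → {n : ℕ | t ++ [n] ∈ T}.Infinite

/-- A Laver tree: closed under initial segments, with a stem. -/
def IsLaverTree (T : Set (List ℕ)) : Prop :=
  (∀ s ∈ T, ∀ t : List ℕ, t <+: s → t ∈ T) ∧ ∃ s, IsStemOf T s

/-- `[T]`, the set of branches of `T`. -/
def branches (T : Set (List ℕ)) : Set (ℕ → ℕ) := {x | ∀ n, seg x n ∈ T}

/-- `S ≤₀ T`: `S` is a Laver tree included in `T` with the same stem. -/
def DirectExt (S T : Set (List ℕ)) : Prop :=
  IsLaverTree S ∧ S ⊆ T ∧ ∃ s, IsStemOf S s ∧ IsStemOf T s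

/-- An (proper, containing all finite sets) ideal on ℕ. -/
def IsIdeal (I : Set (Set ℕ)) : Prop :=
  (∀ A : Set ℕ, A.Finite → A ∈ I) ∧ (∀ A B : Set ℕ, A ⊆ B → B ∈ I → A ∈ I) ∧
    (∀ A B : Set ℕ, A ∈ I → B ∈ I → A ∪ B ∈ I) ∧ (Set.univ : Set ℕ) ∉ I

/-- A P-ideal. -/
def IsPIdeal (I : Set (Set ℕ)) : Prop :=
  ∀ A : ℕ → Set ℕ, (∀ n, A n ∈ I) → ∃ B ∈ I, ∀ n, (A n \ B).Finite

/-- Characteristic function of a subset of ℕ, as a point of the Cantor space. -/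
noncomputable def chi (A : Set ℕ) : ℕ → Bool :=
  fun n => @decide (n ∈ A) (Classical.propDecidable _)

/-- An F_σ set: a countable union of closed sets. -/
def IsFsigma {X : Type*} [TopologicalSpace X] (A : Set X) : Prop :=
  ∃ F : ℕ → Set X, (∀ n, IsClosed (F n)) ∧ A = ⋃ n, F n

/-- An ideal on ℕ is F_σ if its copy in the Cantor space `ℕ → Bool` is F_σ. -/
def FsigmaIdeal (I : Set (Set ℕ)) : Prop := IsFsigma (chi '' I)

/-- The equivalence relation `E_I` on the Cantor space induced by an ideal `I`. -/
def EI (I : Set (Set ℕ)) (x y : ℕ → Bool) : Prop := {n | x n ≠ y n} ∈ I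

/-- The generator `A_g` of the Laver ideal. -/
def laverGen (g : List ℕ → ℕ) : Set (ℕ → ℕ) := {f | {n | f n < g (seg f n)}.Infinite}

/-- Membership in the Laver ideal: covered by countably many generators. -/
def InLaverIdeal (A : Set (ℕ → ℕ)) : Prop :=
  ∃ g : ℕ → List ℕ → ℕ, A ⊆ ⋃ i, laverGen (g i)

/-- The relation `K` on the Baire space. -/
def Krel (x y : ℕ → ℕ) : Prop :=
  ∃ b : ℕ, ∀ n : ℕ, ∃ mx ≤ b, ∃ my ≤ b, x n ≤ y (n + my) ∧ y n ≤ x (n + mx)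

/-- `E_{ℓ∞}` on `ℝ^ℕ`: the difference sequence is bounded. -/
def Elinf (x y : ℕ → ℝ) : Prop := ∃ C : ℝ, ∀ n, |x n - y n| ≤ C

/-- A lower semicontinuous submeasure on ℕ. -/
def IsLSCSubmeasure (μ : Set ℕ → ENNReal) : Prop :=
  μ ∅ = 0 ∧ (∀ A B : Set ℕ, A ⊆ B → μ A ≤ μ B) ∧
    (∀ A B : Set ℕ, μ (A ∪ B) ≤ μ A + μ B) ∧
    ∀ A : Set ℕ, μ A = ⨆ n : ℕ, μ (A ∩ Set.Iio n)

/-- `Exh(μ)`. -/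
def Exh (μ : Set ℕ → ENNReal) : Set (Set ℕ) :=
  {A | Filter.Tendsto (fun n : ℕ => μ (A \ Set.Iio n)) Filter.atTop (nhds 0)}

/-- `Fin(μ)`. -/
def FinSub (μ : Set ℕ → ENNReal) : Set (Set ℕ) := {A | μ A < ⊤}

theorem length_seg (x : ℕ → ℕ) (n : ℕ) : (seg x n).length = n := by simp [seg]

theorem seg_zero (x : ℕ → ℕ) : seg x 0 = [] := by simp [seg]

theorem seg_succ (x : ℕ → ℕ) (n : ℕ) : seg x (n + 1) = seg x n ++ [x n] := by
  rw [seg, List.ofFn_succ', List.concat_eq_append]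
  rfl

theorem getElem_seg (x : ℕ → ℕ) (n k : ℕ) (h : k < (seg x n).length) : (seg x n)[k] = x k := by
  simp [seg]

theorem take_seg (x : ℕ → ℕ) {k n : ℕ} (h : k ≤ n) : (seg x n).take k = seg x k := by
  apply List.ext_getElem
  · simp [length_seg, h]
  · intro i h₁ h₂
    rw [List.getElem_take, getElem_seg, getElem_seg]

/-- `BarRank B u α`: from `u`, one can reach the set `B` while passing infinitely often to
one-step extensions, with rank at most `α`. -/
inductive BarRank (B : Set (List ℕ)) : List ℕ → Ordinal.{0} → Prop
  | base (u : List ℕ) (α : Ordinal.{0}) : u ∈ B → BarRank B u α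
  | step (u : List ℕ) (α : Ordinal.{0}) (c : ℕ → ℕ) (β : ℕ → Ordinal.{0}) :
      (∀ m, m ≤ c m) → (∀ m, β m < α) → (∀ m, BarRank B (u ++ [c m]) (β m)) → BarRank B u α

theorem exists_bar_rank (B : Set (List ℕ)) :
    ∃ (R : Set (List ℕ)) (ρ : List ℕ → Ordinal.{0}),
      (∀ u, u ∉ R → u ∉ B ∧ ∃ m, ∀ n ≥ m, u ++ [n] ∉ R) ∧
      ∀ u ∈ R, u ∈ B ∨ {n | u ++ [n] ∈ R ∧ ρ (u ++ [n]) < ρ u}.Infinite := by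
  refine ⟨{u | ∃ α, BarRank B u α}, fun u => sInf {α | BarRank B u α}, ?_, ?_⟩
  · refine fun u hu => ⟨fun h => hu ⟨0, .base u 0 h⟩, ?_⟩
    by_contra! hc
    choose c hle β hβ using hc
    refine hu ⟨Order.succ (⨆ m, β m), .step u _ c β hle (fun m => ?_) hβ⟩
    exact Order.lt_succ_of_le (Ordinal.le_iSup β m)
  · intro u hu
    have hmem : BarRank B u (sInf {α | BarRank B u α}) := csInf_mem (s := {α | BarRank B u α}) hu
    generalize hα : sInf {α | BarRank B u α} = α at hmem
    cases hmem with
    | base _ _ h => exact .inl h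
    | step _ _ c β hle hlt hr =>
      refine .inr (Set.infinite_of_forall_exists_gt fun m => ⟨c (m + 1), ⟨⟨_, hr _⟩, ?_⟩, ?_⟩)
      · simp only [hα]
        exact (csInf_le' (hr (m + 1))).trans_lt (hlt _)
      · exact hle (m + 1)

section LaverTreeConstruction

variable (P : List ℕ → List ℕ → Prop) (R : List ℕ → Set (List ℕ))
  (ρ : List ℕ → List ℕ → Ordinal.{0}) (s : List ℕ)

open Classical in
/-- Extend the label `t` by one entry if `P` allows it at the node `u`. -/
noncomputable def nextLabel (u t : List ℕ) : List ℕ :=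
  if h : ∃ i, P u (t ++ [i]) then t ++ [h.choose] else t

theorem nextLabel_of_exists {u t : List ℕ} (h : ∃ i, P u (t ++ [i])) :
    ∃ i, nextLabel P u t = t ++ [i] ∧ P u (t ++ [i]) :=
  ⟨h.choose, by rw [nextLabel, dif_pos h], h.choose_spec⟩

theorem nextLabel_of_not_exists {u t : List ℕ} (h : ¬ ∃ i, P u (t ++ [i])) :
    nextLabel P u t = t := by
  rw [nextLabel, dif_neg h]

/-- The immediate successors `u ++ [n]` kept in the tree at a node `u` with label `t`. -/
def GoodStep (u t : List ℕ) (n : ℕ) : Prop :=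
  ((∃ i, P u (t ++ [i])) ∧ P (u ++ [n]) (nextLabel P u t)) ∨
    ((¬ ∃ i, P u (t ++ [i])) ∧ u ++ [n] ∈ R t ∧ ρ t (u ++ [n]) < ρ t u)

/-- `LabelledNode P R ρ s u t`: `u` is a node above the stem `s`, with label `t`. -/
inductive LabelledNode : List ℕ → List ℕ → Prop
  | stem : LabelledNode s []
  | succ (u t : List ℕ) (n : ℕ) :
      LabelledNode u t → GoodStep P R ρ u t n → LabelledNode (u ++ [n]) (nextLabel P u t)

variable {P R ρ s}

theorem LabelledNode.extends_stem {u t : List ℕ} (h : LabelledNode P R ρ s u t) : s <+: u := by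
  induction h with
  | stem => exact List.prefix_rfl
  | succ u t n _ _ ih => exact ih.trans (List.prefix_append _ _)

theorem LabelledNode.cases_eq {v t : List ℕ} (h : LabelledNode P R ρ s v t) :
    (v = s ∧ t = []) ∨ ∃ u t₀ n, v = u ++ [n] ∧ t = nextLabel P u t₀ ∧
      LabelledNode P R ρ s u t₀ ∧ GoodStep P R ρ u t₀ n := by
  cases h with
  | stem => exact .inl ⟨rfl, rfl⟩
  | succ u t n h₁ h₂ => exact .inr ⟨u, t, n, rfl, rfl, h₁, h₂⟩

theorem LabelledNode.label_stem {t : List ℕ} (h : LabelledNode P R ρ s s t) : t = [] := by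
  rcases h.cases_eq with h | ⟨u, t₀, n, hv, -, hu, -⟩
  · exact h.2
  · have h₁ := hu.extends_stem.length_le
    have h₂ := congrArg List.length hv
    simp at h₂
    omega

theorem LabelledNode.label_unique {u t t' : List ℕ} (h : LabelledNode P R ρ s u t)
    (h' : LabelledNode P R ρ s u t') : t = t' := by
  induction h generalizing t' with
  | stem => exact h'.label_stem.symm
  | succ u t n h _ ih =>
    rcases h'.cases_eq with h₁ | ⟨u₁, t₁, n₁, hv, ht, hu, -⟩
    · have h₁ := congrArg List.length h₁.1
      have h₂ := h.extends_stem.length_le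
      simp at h₁
      omega
    · obtain ⟨rfl, -⟩ := List.append_inj' hv rfl
      rw [ht, ih hu]

theorem LabelledNode.of_append {u t' : List ℕ} {n : ℕ} (hsu : s <+: u)
    (h : LabelledNode P R ρ s (u ++ [n]) t') :
    ∃ t, LabelledNode P R ρ s u t ∧ t' = nextLabel P u t ∧ GoodStep P R ρ u t n := by
  rcases h.cases_eq with h | ⟨u₁, t₁, n₁, hv, ht, hu, hg⟩
  · have h₁ := congrArg List.length h.1
    have h₂ := hsu.length_le
    simp at h₁
    omega
  · obtain ⟨rfl, hn⟩ := List.append_inj' hv rfl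
    obtain rfl : n = n₁ := by simpa using hn
    exact ⟨t₁, hu, ht, hg⟩

variable (P R ρ s) in
/-- The tree of labelled nodes, together with the initial segments of the stem. -/
def labelTree : Set (List ℕ) := {u | u <+: s ∨ ∃ t, LabelledNode P R ρ s u t}

theorem isLaverTree_labelTree (hPR : ∀ u t, P u t → u ∈ R t)
    (hP : ∀ u t, P u t → {n | P (u ++ [n]) t}.Infinite)
    (hρ : ∀ t, ∀ u ∈ R t, (∃ i, P u (t ++ [i])) ∨
      {n | u ++ [n] ∈ R t ∧ ρ t (u ++ [n]) < ρ t u}.Infinite)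
    (hs : P s []) : IsLaverTree (labelTree P R ρ s) := by
  have hR : ∀ u t, LabelledNode P R ρ s u t → u ∈ R t := by
    intro u t h
    cases h with
    | stem => exact hPR _ _ hs
    | succ u t n _ hg =>
      rcases hg with ⟨-, h⟩ | ⟨h, h', -⟩
      · exact hPR _ _ h
      · rwa [nextLabel_of_not_exists P h]
  have hsplit : ∀ u t, LabelledNode P R ρ s u t →
      {n : ℕ | u ++ [n] ∈ labelTree P R ρ s}.Infinite := by
    intro u t h
    suffices hg : {n | GoodStep P R ρ u t n}.Infinite from
      hg.mono fun n hn => .inr ⟨_, .succ u t n h hn⟩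
    by_cases hb : ∃ i, P u (t ++ [i])
    · obtain ⟨i, hi, hi'⟩ := nextLabel_of_exists P hb
      refine (hP _ _ hi').mono fun n hn => .inl ⟨hb, ?_⟩
      rw [hi]
      exact hn
    · exact ((hρ t u (hR u t h)).resolve_left hb).mono fun n hn => .inr ⟨hb, hn⟩
  have hclosed : ∀ u t, LabelledNode P R ρ s u t → ∀ v, v <+: u → v ∈ labelTree P R ρ s := by
    intro u t h
    induction h with
    | stem => exact fun v hv => .inl hv
    | succ u t n h hg ih =>
      intro v hv
      rcases List.prefix_concat_iff.1 hv with rfl | hv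
      · exact .inr ⟨_, .succ u t n h hg⟩
      · exact ih v hv
  refine ⟨?_, s, .inl List.prefix_rfl, ?_, ?_⟩
  · rintro u (hu | ⟨t, h⟩) v hv
    · exact .inl (hv.trans hu)
    · exact hclosed u t h v hv
  · rintro u (hu | ⟨t, h⟩)
    · exact .inl hu
    · exact .inr h.extends_stem
  · rintro u (hu | ⟨t, h⟩) hsu
    · obtain rfl : u = s := hu.eq_of_length_le hsu.length_le
      exact hsplit _ _ .stem
    · exact hsplit _ _ h

theorem exists_labels_of_mem_branches {x : ℕ → ℕ} (hx : x ∈ branches (labelTree P R ρ s)) :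
    ∃ t : ℕ → List ℕ, t 0 = [] ∧
      (∀ k, t (k + 1) = nextLabel P (seg x (s.length + k)) (t k)) ∧
      ∀ k, GoodStep P R ρ (seg x (s.length + k)) (t k) (x (s.length + k)) := by
  have hseg : seg x s.length = s := by
    rcases hx s.length with h | ⟨t, h⟩
    · exact h.eq_of_length (length_seg _ _)
    · exact (h.extends_stem.eq_of_length (length_seg _ _).symm).symm
  have hnode : ∀ k, ∃ t, LabelledNode P R ρ s (seg x (s.length + k)) t := by
    intro k
    rcases hx (s.length + k) with h | h
    · have h₁ := h.length_le
      rw [length_seg] at h₁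
      obtain rfl : k = 0 := by omega
      rw [add_zero, hseg]
      exact ⟨[], .stem⟩
    · exact h
  choose t ht using hnode
  have hstep : ∀ k, t (k + 1) = nextLabel P (seg x (s.length + k)) (t k) ∧
      GoodStep P R ρ (seg x (s.length + k)) (t k) (x (s.length + k)) := by
    intro k
    have h := ht (k + 1)
    rw [← add_assoc, seg_succ] at h
    obtain ⟨t₀, h₁, h₂, h₃⟩ := h.of_append (ht k).extends_stem
    obtain rfl := h₁.label_unique (ht k)
    exact ⟨h₂, h₃⟩
  refine ⟨t, ?_, fun k => (hstep k).1, fun k => (hstep k).2⟩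
  have h := ht 0
  rw [add_zero, hseg] at h
  exact h.label_stem

theorem exists_seg_eq_of_prefix_chain {t : ℕ → List ℕ} (hmono : ∀ k, t k <+: t (k + 1))
    (hunb : ∀ m, ∃ k, m ≤ (t k).length) : ∃ y : ℕ → ℕ, ∀ k, seg y (t k).length = t k := by
  have hle : ∀ j k, j ≤ k → t j <+: t k := by
    intro j k hjk
    induction k, hjk using Nat.le_induction with
    | base => exact List.prefix_rfl
    | succ k _ ih => exact ih.trans (hmono k)
  choose N hN using fun m => hunb (m + 1)
  refine ⟨fun m => (t (N m))[m]'(hN m), fun k => ?_⟩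
  apply List.ext_getElem (length_seg _ _)
  intro i h₁ h₂
  rw [getElem_seg]
  rcases le_total (N i) k with h | h
  · exact (hle _ _ h).getElem _
  · exact ((hle _ _ h).getElem h₂).symm

theorem exists_witness_of_mem_branches {x : ℕ → ℕ} (hx : x ∈ branches (labelTree P R ρ s)) :
    ∃ y : ℕ → ℕ, ∀ K, ∃ n ≥ K, ∃ m ≥ K, P (seg x n) (seg y m) := by
  obtain ⟨t, -, hnext, hgood⟩ := exists_labels_of_mem_branches hx
  have hinc : ∀ k, ∃ j ≥ k, ∃ i, P (seg x (s.length + j)) (t j ++ [i]) := by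
    intro k
    by_contra! hc
    have hne : ∀ j ≥ k, ¬ ∃ i, P (seg x (s.length + j)) (t j ++ [i]) := by
      intro j hj ⟨i, hi⟩
      exact hc j hj i hi
    have hconst : ∀ j ≥ k, t j = t k := by
      intro j hj
      induction j, hj using Nat.le_induction with
      | base => rfl
      | succ j hj ih => rw [hnext, nextLabel_of_not_exists P (hne j hj), ih]
    refine not_strictAnti_of_wellFoundedLT
      (fun j => ρ (t k) (seg x (s.length + (k + j)))) (strictAnti_nat_of_succ_lt fun j => ?_)
    have hj : k ≤ k + j := Nat.le_add_right _ _
    rcases hgood (k + j) with h | h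
    · exact absurd h.1 (hne _ hj)
    · have h' := h.2.2
      rw [← seg_succ, hconst _ hj] at h'
      exact h'
  have hmono : ∀ k, t k <+: t (k + 1) := by
    intro k
    rw [hnext]
    by_cases h : ∃ i, P (seg x (s.length + k)) (t k ++ [i])
    · obtain ⟨i, hi, -⟩ := nextLabel_of_exists P h
      rw [hi]
      exact List.prefix_append _ _
    · rw [nextLabel_of_not_exists P h]
  have hlen : ∀ j k, j ≤ k → (t j).length ≤ (t k).length := fun _ _ h =>
    monotone_nat_of_le_succ (f := fun k => (t k).length) (fun k => (hmono k).length_le) h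
  have hsucc : ∀ j, (∃ i, P (seg x (s.length + j)) (t j ++ [i])) →
      (t (j + 1)).length = (t j).length + 1 ∧ P (seg x (s.length + j)) (t (j + 1)) := by
    intro j h
    obtain ⟨i, hi, hi'⟩ := nextLabel_of_exists P h
    rw [hnext, hi]
    exact ⟨by simp, hi'⟩
  have hunb : ∀ m, ∃ k, m ≤ (t k).length := by
    intro m
    induction m with
    | zero => exact ⟨0, Nat.zero_le _⟩
    | succ m ih =>
      obtain ⟨k, hk⟩ := ih
      obtain ⟨j, hj, h⟩ := hinc k
      refine ⟨j + 1, ?_⟩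
      have := hlen k j hj
      have := (hsucc j h).1
      omega
  obtain ⟨y, hy⟩ := exists_seg_eq_of_prefix_chain hmono hunb
  refine ⟨y, fun K => ?_⟩
  obtain ⟨k, hk⟩ := hunb K
  obtain ⟨j, hj, h⟩ := hinc (max k K)
  have hkj : k ≤ j := (le_max_left _ _).trans hj
  have hKj : K ≤ j := (le_max_right _ _).trans hj
  refine ⟨s.length + j, by omega, (t (j + 1)).length,
    hk.trans (hlen k (j + 1) (by omega)), ?_⟩
  rw [hy]
  exact (hsucc j h).2

end LaverTreeConstruction

/-- No bound `g` is violated, past `s`, by all points of the image under `f` of the cylinder `t`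
which extend `s`. -/
def LaverPositive (f : (ℕ → ℕ) → ℕ → ℕ) (s t : List ℕ) : Prop :=
  ∀ g : List ℕ → ℕ, ∃ z, seg z t.length = t ∧ seg (f z) s.length = s ∧
    ∀ n ≥ s.length, g (seg (f z) n) ≤ f z n

theorem LaverPositive.infinite_succ {f : (ℕ → ℕ) → ℕ → ℕ} {s t : List ℕ}
    (h : LaverPositive f s t) : {n | LaverPositive f (s ++ [n]) t}.Infinite := by
  intro hfin
  obtain ⟨b, hb⟩ := hfin.bddAbove
  have hg : ∀ n, ∃ g : List ℕ → ℕ, ¬ LaverPositive f (s ++ [n]) t →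
      ∀ z, seg z t.length = t → seg (f z) (s ++ [n]).length = s ++ [n] →
        ¬ ∀ m ≥ (s ++ [n]).length, g (seg (f z) m) ≤ f z m := by
    intro n
    by_cases hn : LaverPositive f (s ++ [n]) t
    · exact ⟨0, fun h => absurd hn h⟩
    · unfold LaverPositive at hn
      push Not at hn
      obtain ⟨g, hg⟩ := hn
      refine ⟨g, fun _ z h₁ h₂ h₃ => ?_⟩
      obtain ⟨m, hm, hlt⟩ := hg z h₁ h₂
      exact absurd (h₃ m hm) (not_le.2 hlt)
  choose G hG using hg
  obtain ⟨z, hz, hs, hle⟩ := h fun u => b + 1 + G (u.getD s.length 0) u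
  have hpos : ¬ LaverPositive f (s ++ [f z s.length]) t := by
    intro hp
    have h₁ : f z s.length ≤ b := hb hp
    have h₂ := hle s.length le_rfl
    omega
  refine hG _ hpos z hz ?_ fun m hm => ?_
  · rw [List.length_append, List.length_singleton, seg_succ, hs]
  · rw [List.length_append, List.length_singleton] at hm
    have hm' : s.length < (seg (f z) m).length := by rw [length_seg]; omega
    have h₁ := hle m (by omega)
    rw [List.getD_eq_getElem _ _ hm', getElem_seg] at h₁
    exact le_trans (Nat.le_add_left _ _) h₁

theorem LaverPositive.mem_bar {f : (ℕ → ℕ) → ℕ → ℕ} {s t : List ℕ} {R : Set (List ℕ)}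
    (hR : ∀ u, u ∉ R → (¬ ∃ i, LaverPositive f u (t ++ [i])) ∧ ∃ m, ∀ n ≥ m, u ++ [n] ∉ R)
    (h : LaverPositive f s t) : s ∈ R := by
  by_contra hsR
  have hm : ∀ u, ∃ m, u ∉ R → ∀ n ≥ m, u ++ [n] ∉ R := by
    intro u
    by_cases hu : u ∈ R
    · exact ⟨0, fun h => absurd hu h⟩
    · obtain ⟨m, hm⟩ := (hR u hu).2
      exact ⟨m, fun _ => hm⟩
  choose M hM using hm
  have hg : ∀ u i, ∃ g : List ℕ → ℕ, ¬ LaverPositive f u (t ++ [i]) →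
      ∀ z, seg z (t ++ [i]).length = t ++ [i] → seg (f z) u.length = u →
        ¬ ∀ m ≥ u.length, g (seg (f z) m) ≤ f z m := by
    intro u i
    by_cases hn : LaverPositive f u (t ++ [i])
    · exact ⟨0, fun h => absurd hn h⟩
    · unfold LaverPositive at hn
      push Not at hn
      obtain ⟨g, hg⟩ := hn
      refine ⟨g, fun _ z h₁ h₂ h₃ => ?_⟩
      obtain ⟨m, hm, hlt⟩ := hg z h₁ h₂
      exact absurd (h₃ m hm) (not_le.2 hlt)
  choose G hG using hg
  obtain ⟨z, hz, hs, hle⟩ := h fun u => max (M u)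
    ((Finset.range (u.length + 1) ×ˢ Finset.range (u.length + 1)).sup
      fun p => G (u.take p.1) p.2 u)
  have hout : ∀ n ≥ s.length, seg (f z) n ∉ R := by
    intro n hn
    induction n, hn using Nat.le_induction with
    | base => rwa [hs]
    | succ n hn ih =>
      rw [seg_succ]
      exact hM _ ih _ ((le_max_left _ _).trans (hle n hn))
  set N := max s.length (z t.length)
  refine hG (seg (f z) N) (z t.length)
    (fun hp => (hR _ (hout N (le_max_left _ _))).1 ⟨_, hp⟩) z ?_ ?_ fun m hm => ?_
  · rw [List.length_append, List.length_singleton, seg_succ, hz]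
  · rw [length_seg]
  · rw [length_seg] at hm
    have hsm : s.length ≤ m := (le_max_left _ _).trans hm
    have him : z t.length ≤ m := (le_max_right _ _).trans hm
    refine le_trans ?_ ((le_max_right _ _).trans (hle m hsm))
    have hmem : (N, z t.length) ∈ Finset.range ((seg (f z) m).length + 1) ×ˢ
        Finset.range ((seg (f z) m).length + 1) := by
      simp only [Finset.mem_product, Finset.mem_range, length_seg]
      omega
    have hsup := Finset.le_sup (f := fun p : ℕ × ℕ => G ((seg (f z) m).take p.1) p.2 (seg (f z) m))
      hmem
    rwa [take_seg _ hm] at hsup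

theorem inLaverIdeal_range_of_not_laverPositive {f : (ℕ → ℕ) → ℕ → ℕ}
    (h : ∀ s, ¬ LaverPositive f s []) : InLaverIdeal (range f) := by
  unfold LaverPositive at h
  push Not at h
  choose G hG using h
  refine ⟨fun _ u => (Finset.range (u.length + 1)).sup fun k => G (u.take k) u, ?_⟩
  rintro _ ⟨z, rfl⟩
  refine mem_iUnion.2 ⟨0, infinite_of_forall_exists_gt fun k => ?_⟩
  obtain ⟨n, hn, hlt⟩ := hG (seg (f z) (k + 1)) z (by simp [seg_zero]) (by rw [length_seg])
  rw [length_seg] at hn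
  refine ⟨n, ?_, hn⟩
  refine lt_of_lt_of_le hlt ?_
  have hsup := Finset.le_sup (f := fun j => G ((seg (f z) n).take j) (seg (f z) n))
    (show k + 1 ∈ Finset.range ((seg (f z) n).length + 1) by
      rw [Finset.mem_range, length_seg]; omega)
  rwa [take_seg _ hn] at hsup

theorem tendsto_of_forall_seg_eq {x : ℕ → ℕ} {z : ℕ → ℕ → ℕ} {n : ℕ → ℕ} (hn : ∀ K, K ≤ n K)
    (h : ∀ K, seg (z K) (n K) = seg x (n K)) : Tendsto z atTop (nhds x) := by
  refine tendsto_pi_nhds.2 fun i => tendsto_const_nhds.congr' ?_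
  filter_upwards [eventually_gt_atTop i] with K hK
  have hi : i < n K := hK.trans_le (hn K)
  have h₁ := getElem_seg (z K) (n K) i (by rwa [length_seg])
  have h₂ := getElem_seg x (n K) i (by rwa [length_seg])
  simp only [h] at h₁
  exact h₂.symm.trans h₁

/-- an analytic subset of the Baire space either contains all
branches of a Laver tree or lies in the Laver ideal. -/
theorem stmt2 (A : Set (ℕ → ℕ)) (hA : MeasureTheory.AnalyticSet A) :
    (∃ T, IsLaverTree T ∧ branches T ⊆ A) ∨ InLaverIdeal A := by
  rw [MeasureTheory.AnalyticSet] at hA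
  rcases hA with rfl | ⟨f, hf, rfl⟩
  · exact .inr ⟨fun _ _ => 0, empty_subset _⟩
  by_cases hpos : ∃ s, LaverPositive f s []
  swap
  · exact .inr (inLaverIdeal_range_of_not_laverPositive (not_exists.1 hpos))
  obtain ⟨s, hs⟩ := hpos
  choose R ρ hR hρ using fun t => exists_bar_rank {u | ∃ i, LaverPositive f u (t ++ [i])}
  refine .inl ⟨labelTree (LaverPositive f) R ρ s, isLaverTree_labelTree
    (fun u t h => h.mem_bar (hR t)) (fun u t h => h.infinite_succ) hρ hs, fun x hx => ?_⟩
  obtain ⟨y, hy⟩ := exists_witness_of_mem_branches hx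
  choose n hn m hm hP using hy
  choose z hz hfz _ using fun K => hP K fun _ => 0
  simp only [length_seg] at hz hfz
  exact ⟨y, tendsto_nhds_unique ((hf.tendsto y).comp (tendsto_of_forall_seg_eq hm hz))
    (tendsto_of_forall_seg_eq hn hfz)⟩
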